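/- The set of all Minkowski bases of classes of finite equivalence, i.e. the set {closure of H(X) in 𝔐 : X a Banach space} of closed subsets of the Minkowski space 𝔐, has cardinality exactly the continuum 𝔠 = 2^ω. -/

import Mathlib

noncomputable section

universe u

/-- A packaged real Banach space. -/
structure BanachSpace : Type (u + 1) where
  carrier : Type u
  [norm : NormedAddCommGroup carrier]
  [smulR : NormedSpace ℝ carrier]
  [complete : CompleteSpace carrier]

attribute [instance] BanachSpace.norm BanachSpace.smulR BanachSpace.complete

/-- A norm on `ℝ^n`. An `n`-dimensional real Banach space is (isometric to) `ℝ^n`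
equipped with such a norm. -/
structure MNorm (n : ℕ) : Type where
  toFun : (Fin n → ℝ) → ℝ
  add_le' : ∀ x y, toFun (x + y) ≤ toFun x + toFun y
  smul_eq' : ∀ (a : ℝ) (x), toFun (a • x) = |a| * toFun x
  eq_zero' : ∀ x, toFun x = 0 → x = 0

/-- Two norms on `ℝ^n` are identified when they are linearly isometrically equivalent. -/
def mnormSetoid (n : ℕ) : Setoid (MNorm n) where
  r N₁ N₂ := ∃ e : (Fin n → ℝ) ≃ₗ[ℝ] (Fin n → ℝ), ∀ x, N₂.toFun (e x) = N₁.toFun x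
  iseqv := by
    constructor
    · exact fun N => ⟨LinearEquiv.refl ℝ _, fun x => rfl⟩
    · rintro N₁ N₂ ⟨e, he⟩
      refine ⟨e.symm, fun x => ?_⟩
      have h := he (e.symm x)
      rw [e.apply_symm_apply] at h
      exact h.symm
    · rintro N₁ N₂ N₃ ⟨e, he⟩ ⟨f, hf⟩
      exact ⟨e.trans f, fun x => by
        rw [LinearEquiv.trans_apply, hf, he]⟩

/-- The Minkowski compact `𝔐_n`: isometry classes of `n`-dimensional real Banach spaces. -/
def Mink (n : ℕ) : Type := Quotient (mnormSetoid n)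

/-- The Minkowski space `𝔐`: the disjoint union of the `𝔐_n`. -/
def MinkSpace : Type := Σ n : ℕ, Mink n

/-- The operator norm of a linear map `u : (ℝ^n, N₁) → (ℝ^n, N₂)`. -/
noncomputable def opC (n : ℕ) (N₁ N₂ : MNorm n)
    (u : (Fin n → ℝ) →ₗ[ℝ] (Fin n → ℝ)) : ℝ :=
  sInf {C : ℝ | 0 ≤ C ∧ ∀ x, N₂.toFun (u x) ≤ C * N₁.toFun x}

/-- The multiplicative Banach–Mazur distance between two norms on `ℝ^n`:
`inf {‖u‖·‖u⁻¹‖ : u a linear isomorphism}`. -/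
noncomputable def mDist (n : ℕ) (N₁ N₂ : MNorm n) : ℝ :=
  sInf {c : ℝ | ∃ u : (Fin n → ℝ) ≃ₗ[ℝ] (Fin n → ℝ),
    c = opC n N₁ N₂ u.toLinearMap * opC n N₂ N₁ u.symm.toLinearMap}

/-- The Banach–Mazur metric `log d` on `𝔐_n`. -/
noncomputable def minkDist (n : ℕ) (P Q : Mink n) : ℝ :=
  Real.log (mDist n P.out Q.out)

/-- The topology of the Banach–Mazur metric on `𝔐_n` (generated by its open balls). -/
instance minkTopology (n : ℕ) : TopologicalSpace (Mink n) :=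
  TopologicalSpace.generateFrom
    {s : Set (Mink n) | ∃ (P : Mink n) (ε : ℝ), 0 < ε ∧ s = {Q | minkDist n P Q < ε}}

instance : TopologicalSpace MinkSpace := by
  unfold MinkSpace; infer_instance

/-- The class in `𝔐` determined by a norm on `ℝ^n`. -/
def minkClass {n : ℕ} (N : MNorm n) : MinkSpace := ⟨n, Quotient.mk (mnormSetoid n) N⟩

/-- `H(X) ⊆ 𝔐`: the set of isometry classes of finite-dimensional subspaces of `X`.
A class `c` belongs to `H(X)` iff `ℝ^{c.1}` with (a representative of) the norm class `c.2`
embeds linearly isometrically into `X`. -/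
def HSet (X : Type u) [SeminormedAddCommGroup X] [NormedSpace ℝ X] : Set MinkSpace :=
  {c : MinkSpace | ∃ f : (Fin c.1 → ℝ) →ₗ[ℝ] X, Function.Injective f ∧
    ∀ v, ‖f v‖ = (Quotient.out c.2).toFun v}

/-- `H_m(X) ⊆ 𝔐_m`: the set of isometry classes of `m`-dimensional subspaces of `X`. -/
def HmSet (m : ℕ) (X : Type u) [SeminormedAddCommGroup X] [NormedSpace ℝ X] : Set (Mink m) :=
  {P : Mink m | ∃ f : (Fin m → ℝ) →ₗ[ℝ] X, Function.Injective f ∧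
    ∀ v, ‖f v‖ = (Quotient.out P).toFun v}

/-- `ℝ^n` equipped with the norm `N`. -/
def MNorm.Space {n : ℕ} (_ : MNorm n) : Type := Fin n → ℝ

namespace MNorm

variable {n : ℕ}

instance (N : MNorm n) : AddCommGroup N.Space := inferInstanceAs (AddCommGroup (Fin n → ℝ))

instance (N : MNorm n) : Module ℝ N.Space := inferInstanceAs (Module ℝ (Fin n → ℝ))

lemma map_zero (N : MNorm n) : N.toFun 0 = 0 := by
  simpa using N.smul_eq' 0 0

lemma map_neg (N : MNorm n) (x : Fin n → ℝ) : N.toFun (-x) = N.toFun x := by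
  simpa using N.smul_eq' (-1) x

lemma nonneg (N : MNorm n) (x : Fin n → ℝ) : 0 ≤ N.toFun x := by
  have h := N.add_le' x (-x)
  rw [add_neg_cancel, N.map_zero, N.map_neg] at h
  linarith

instance (N : MNorm n) : NormedAddCommGroup N.Space :=
  AddGroupNorm.toNormedAddCommGroup
    { toFun := N.toFun
      map_zero' := N.map_zero
      add_le' := N.add_le'
      neg' := N.map_neg
      eq_zero_of_map_eq_zero' := N.eq_zero' }

instance (N : MNorm n) : NormedSpace ℝ N.Space where
  norm_smul_le a x := (N.smul_eq' a x).le

/-- The identity map from `ℝ^n` to `ℝ^n` with the norm `N`. -/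
def equivSpace (N : MNorm n) : (Fin n → ℝ) ≃ₗ[ℝ] N.Space := LinearEquiv.refl ℝ (Fin n → ℝ)

instance (N : MNorm n) : FiniteDimensional ℝ N.Space :=
  N.equivSpace.finiteDimensional

lemma norm_equivSpace (N : MNorm n) (x : Fin n → ℝ) : ‖N.equivSpace x‖ = N.toFun x := rfl

lemma continuous_toFun (N : MNorm n) : Continuous N.toFun :=
  continuous_norm.comp N.equivSpace.toLinearMap.continuous_of_finiteDimensional

lemma exists_norm_le (N : MNorm n) : ∃ K : ℝ, 0 < K ∧ ∀ x, ‖x‖ ≤ K * N.toFun x := by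
  obtain ⟨K, hK, h⟩ :=
    (LinearMap.toContinuousLinearMap N.equivSpace.symm.toLinearMap).bound
  exact ⟨K, hK, fun x => h (N.equivSpace x)⟩

lemma exists_map_le (A B : MNorm n) (u : (Fin n → ℝ) →ₗ[ℝ] (Fin n → ℝ)) :
    ∃ C : ℝ, 0 ≤ C ∧ ∀ x, B.toFun (u x) ≤ C * A.toFun x := by
  obtain ⟨K, hK, h⟩ := (LinearMap.toContinuousLinearMap
    (B.equivSpace.toLinearMap ∘ₗ u ∘ₗ A.equivSpace.symm.toLinearMap)).bound
  exact ⟨K, hK.le, fun x => h (A.equivSpace x)⟩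

lemma opC_nonneg (A B : MNorm n) (u : (Fin n → ℝ) →ₗ[ℝ] (Fin n → ℝ)) : 0 ≤ opC n A B u :=
  Real.sInf_nonneg fun _ h => h.1

lemma opC_le (A B : MNorm n) (u : (Fin n → ℝ) →ₗ[ℝ] (Fin n → ℝ)) {C : ℝ} (hC : 0 ≤ C)
    (h : ∀ x, B.toFun (u x) ≤ C * A.toFun x) : opC n A B u ≤ C :=
  csInf_le ⟨0, fun _ h => h.1⟩ ⟨hC, h⟩

lemma map_le_opC (A B : MNorm n) (u : (Fin n → ℝ) →ₗ[ℝ] (Fin n → ℝ)) (x : Fin n → ℝ) :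
    B.toFun (u x) ≤ opC n A B u * A.toFun x := by
  rcases (A.nonneg x).eq_or_lt with h0 | h0
  · rw [A.eq_zero' x h0.symm]
    simp [map_zero]
  · rw [← div_le_iff₀ h0]
    exact le_csInf (exists_map_le A B u) fun C hC => (div_le_iff₀ h0).2 (hC.2 x)

lemma mDist_nonneg (A B : MNorm n) : 0 ≤ mDist n A B := by
  refine Real.sInf_nonneg ?_
  rintro _ ⟨u, rfl⟩
  exact mul_nonneg (opC_nonneg _ _ _) (opC_nonneg _ _ _)

lemma mDist_lt_iff {A B : MNorm n} {c : ℝ} :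
    mDist n A B < c ↔ ∃ (u : (Fin n → ℝ) ≃ₗ[ℝ] (Fin n → ℝ)) (a b : ℝ), 0 ≤ a ∧ 0 ≤ b ∧ a * b < c ∧
      (∀ x, B.toFun (u x) ≤ a * A.toFun x) ∧ ∀ x, A.toFun (u.symm x) ≤ b * B.toFun x := by
  constructor
  · intro h
    obtain ⟨_, ⟨u, rfl⟩, hu⟩ := exists_lt_of_csInf_lt (by exact
      ⟨_, LinearEquiv.refl ℝ (Fin n → ℝ), rfl⟩) h
    exact ⟨u, _, _, opC_nonneg _ _ _, opC_nonneg _ _ _, hu, map_le_opC A B u.toLinearMap,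
      map_le_opC B A u.symm.toLinearMap⟩
  · rintro ⟨u, a, b, ha, hb, hab, hA, hB⟩
    refine lt_of_le_of_lt (le_trans (csInf_le ⟨0, ?_⟩ ⟨u, rfl⟩) ?_) hab
    · rintro _ ⟨v, rfl⟩
      exact mul_nonneg (opC_nonneg _ _ _) (opC_nonneg _ _ _)
    · exact mul_le_mul (opC_le A B _ ha hA) (opC_le B A _ hb hB) (opC_nonneg _ _ _) ha

lemma mDist_lt_of_isometric {A B A' B' : MNorm n} (hA : (mnormSetoid n).r A A')
    (hB : (mnormSetoid n).r B B') {c : ℝ} (h : mDist n A B < c) : mDist n A' B' < c := by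
  obtain ⟨e, he⟩ := hA
  obtain ⟨f, hf⟩ := hB
  rw [mDist_lt_iff] at h ⊢
  obtain ⟨u, a, b, ha, hb, hab, h1, h2⟩ := h
  refine ⟨e.symm.trans (u.trans f), a, b, ha, hb, hab, fun x => ?_, fun x => ?_⟩
  · have := h1 (e.symm x)
    rw [← hf, ← he, e.apply_symm_apply] at this
    exact this
  · have := h2 (f.symm x)
    rw [← hf, ← he, f.apply_symm_apply] at this
    exact this

/-- The isometry class of a norm on `ℝ^n`. -/
def toMink (N : MNorm n) : Mink n := Quotient.mk (mnormSetoid n) N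

lemma out_toMink_rel (N : MNorm n) : (mnormSetoid n).r (Quotient.out N.toMink) N :=
  Quotient.mk_out (s := mnormSetoid n) N

lemma toMink_out (P : Mink n) : toMink (Quotient.out P) = P := Quotient.out_eq P

lemma minkDist_toMink_lt_iff (A B : MNorm n) {ε : ℝ} (hε : 0 < ε) :
    minkDist n A.toMink B.toMink < ε ↔ mDist n A B < Real.exp ε := by
  have key : ∀ x : ℝ, 0 ≤ x → (Real.log x < ε ↔ x < Real.exp ε) := by
    intro x hx
    rcases hx.eq_or_lt with rfl | hx
    · simp [hε, Real.exp_pos]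
    · exact Real.log_lt_iff_lt_exp hx
  have hA := A.out_toMink_rel
  have hB := B.out_toMink_rel
  rw [minkDist, key _ (mDist_nonneg _ _)]
  exact ⟨mDist_lt_of_isometric hA hB,
    mDist_lt_of_isometric ((mnormSetoid n).symm hA) ((mnormSetoid n).symm hB)⟩

/-- The restriction of a norm to the unit sphere of the supremum norm. -/
def onSphere (N : MNorm n) : C(Metric.sphere (0 : Fin n → ℝ) 1, ℝ) :=
  ⟨fun x => N.toFun x, N.continuous_toFun.comp continuous_subtype_val⟩

lemma abs_sub_le (A B : MNorm n) (x : Fin n → ℝ) :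
    |A.toFun x - B.toFun x| ≤ dist A.onSphere B.onSphere * ‖x‖ := by
  rcases eq_or_ne x 0 with rfl | hx
  · simp [map_zero]
  have hx' : 0 < ‖x‖ := norm_pos_iff.2 hx
  have hmem : ‖x‖⁻¹ • x ∈ Metric.sphere (0 : Fin n → ℝ) 1 := by
    simp [norm_smul, hx'.ne']
  have h := ContinuousMap.dist_apply_le_dist (f := A.onSphere) (g := B.onSphere) ⟨_, hmem⟩
  have h' : |A.toFun (‖x‖⁻¹ • x) - B.toFun (‖x‖⁻¹ • x)| ≤ dist A.onSphere B.onSphere := h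
  rw [A.smul_eq', B.smul_eq', ← mul_sub, abs_mul, abs_abs, abs_of_pos (inv_pos.2 hx'),
    inv_mul_le_iff₀ hx', mul_comm] at h'
  exact h'

instance : TopologicalSpace (MNorm n) := TopologicalSpace.induced onSphere inferInstance

instance : SecondCountableTopology (MNorm n) :=
  TopologicalSpace.secondCountableTopology_induced _ _ onSphere

lemma isOpen_setOf_mDist_lt (A : MNorm n) (c : ℝ) : IsOpen {B : MNorm n | mDist n A B < c} := by
  rw [isOpen_iff_mem_nhds]
  intro B hB
  obtain ⟨u, a, b, ha, hb, hab, h1, h2⟩ := mDist_lt_iff.1 hB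
  obtain ⟨K, hK, hKB⟩ := B.exists_norm_le
  have hcont : Filter.Tendsto (fun B' : MNorm n => K * dist B'.onSphere B.onSphere)
      (nhds B) (nhds 0) := by
    have h : Continuous fun B' : MNorm n => K * dist B'.onSphere B.onSphere :=
      continuous_const.mul (continuous_induced_dom.dist continuous_const)
    simpa using h.tendsto B
  have hlim : Filter.Tendsto (fun η : ℝ => (a * (1 + η)) * (b * (1 - η)⁻¹)) (nhds 0)
      (nhds (a * b)) := by
    have h : ContinuousAt (fun η : ℝ => (a * (1 + η)) * (b * (1 - η)⁻¹)) 0 := by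
      refine ContinuousAt.mul (by fun_prop) (continuousAt_const.mul (ContinuousAt.inv₀ ?_ ?_))
      · fun_prop
      · simp
    simpa [ContinuousAt] using h
  filter_upwards [hcont.eventually (hlim.eventually_lt_const hab),
    hcont.eventually_lt_const one_pos] with B' hlt hone
  set η := K * dist B'.onSphere B.onSphere with hη
  have hη0 : 0 ≤ η := by positivity
  have hdiff : ∀ x, |B'.toFun x - B.toFun x| ≤ η * B.toFun x := fun x =>
    calc |B'.toFun x - B.toFun x| ≤ dist B'.onSphere B.onSphere * ‖x‖ := abs_sub_le _ _ _
      _ ≤ dist B'.onSphere B.onSphere * (K * B.toFun x) := by gcongr; exact hKB x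
      _ = η * B.toFun x := by rw [hη]; ring
  have hpos : 0 < 1 - η := by linarith
  refine mDist_lt_iff.2 ⟨u, _, _, by positivity, by positivity, hlt, fun x => ?_, fun x => ?_⟩
  · have h3 := (abs_le.1 (hdiff (u x))).2
    have h4 := mul_le_mul_of_nonneg_left (h1 x) (by positivity : 0 ≤ 1 + η)
    nlinarith
  · have h3 := (abs_le.1 (hdiff x)).1
    have h4 : B.toFun x ≤ (1 - η)⁻¹ * B'.toFun x := by
      rw [le_inv_mul_iff₀ hpos]; linarith
    calc A.toFun (u.symm x) ≤ b * B.toFun x := h2 x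
      _ ≤ b * ((1 - η)⁻¹ * B'.toFun x) := by gcongr
      _ = _ := by ring

lemma continuous_toMink : Continuous (toMink : MNorm n → Mink n) := by
  refine continuous_generateFrom_iff.2 ?_
  rintro _ ⟨P, ε, hε, rfl⟩
  rw [← toMink_out P]
  convert isOpen_setOf_mDist_lt (Quotient.out P) (Real.exp ε) using 1
  ext B
  exact minkDist_toMink_lt_iff _ B hε

lemma continuous_minkClass : Continuous fun N : Σ n, MNorm n => minkClass N.2 :=
  continuous_sigma fun _ => continuous_sigmaMk.comp continuous_toMink

lemma surjective_minkClass : Function.Surjective fun N : Σ n, MNorm n => minkClass N.2 := by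
  rintro ⟨n, P⟩
  exact ⟨⟨n, Quotient.out P⟩, congrArg (Sigma.mk n) (toMink_out P)⟩

end MNorm

lemma mk_isClosed_le_continuum (α : Type*) [TopologicalSpace α] [SecondCountableTopology α] :
    Cardinal.mk {s : Set α | IsClosed s} ≤ Cardinal.continuum := by
  let b := TopologicalSpace.countableBasis α
  have hb := TopologicalSpace.isBasis_countableBasis α
  let F : {s : Set α | IsClosed s} → Set b := fun s => {t | (t : Set α) ⊆ (s : Set α)ᶜ}
  have hF : Function.Injective F := by
    intro s t hst
    refine Subtype.ext (compl_injective ?_)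
    rw [hb.open_eq_sUnion' s.2.isOpen_compl, hb.open_eq_sUnion' t.2.isOpen_compl]
    congr 1
    ext v
    exact and_congr_right fun hv => Set.ext_iff.1 hst ⟨v, hv⟩
  have hcount : Cardinal.mk b ≤ Cardinal.aleph0 :=
    (TopologicalSpace.countable_countableBasis α).le_aleph0
  calc _ ≤ Cardinal.mk (Set b) := Cardinal.mk_le_of_injective hF
    _ = 2 ^ Cardinal.mk b := Cardinal.mk_set
    _ ≤ 2 ^ Cardinal.aleph0 := Cardinal.power_le_power_left two_ne_zero hcount
    _ = _ := Cardinal.two_power_aleph0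

lemma mk_isClosed_minkSpace_le :
    Cardinal.mk {s : Set MinkSpace | IsClosed s} ≤ Cardinal.continuum := by
  refine le_trans (Cardinal.mk_le_of_injective (f := fun s : {s : Set MinkSpace | IsClosed s} =>
    (⟨_, s.2.preimage MNorm.continuous_minkClass⟩ : {s : Set (Σ n, MNorm n) | IsClosed s})) ?_)
    (mk_isClosed_le_continuum _)
  intro s t h
  exact Subtype.ext (MNorm.surjective_minkClass.preimage_injective (congrArg Subtype.val h))

/-- The norm `√(x₀² + x₁² + 2t|x₀x₁|)` on the plane. -/
def planeNorm (t : Set.Ico (0 : ℝ) 1) : MNorm 2 where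
  toFun x := √(x 0 ^ 2 + x 1 ^ 2 + 2 * t * (|x 0| * |x 1|))
  add_le' x y := by
    obtain ⟨t, h0, h1⟩ := t
    have key : ∀ a b c d : ℝ, 0 ≤ a → 0 ≤ b → 0 ≤ c → 0 ≤ d →
        √((a + c) ^ 2 + (b + d) ^ 2 + 2 * t * ((a + c) * (b + d))) ≤
        √(a ^ 2 + b ^ 2 + 2 * t * (a * b)) + √(c ^ 2 + d ^ 2 + 2 * t * (c * d)) := by
      intro a b c d ha hb hc hd
      rw [Real.sqrt_le_left (by positivity), add_sq (√_), Real.sq_sqrt (by positivity),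
        Real.sq_sqrt (by positivity), mul_assoc 2 (√_), ← Real.sqrt_mul (by positivity)]
      have h : a * c + b * d + t * (a * d + b * c) ≤
          √((a ^ 2 + b ^ 2 + 2 * t * (a * b)) * (c ^ 2 + d ^ 2 + 2 * t * (c * d))) := by
        refine Real.le_sqrt_of_sq_le ?_
        have : 0 ≤ (1 - t ^ 2) * (a * d - b * c) ^ 2 :=
          mul_nonneg (by nlinarith) (sq_nonneg _)
        linarith
      linarith
    refine le_trans (Real.sqrt_le_sqrt ?_)
      ((key |x 0| |x 1| |y 0| |y 1| (abs_nonneg _) (abs_nonneg _) (abs_nonneg _)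
        (abs_nonneg _)).trans_eq (by simp only [sq_abs]))
    simp only [Pi.add_apply]
    rw [← sq_abs (x 0 + y 0), ← sq_abs (x 1 + y 1)]
    have hx := abs_add_le (x 0) (y 0)
    have hy := abs_add_le (x 1) (y 1)
    gcongr
  smul_eq' a x := by
    simp only [Pi.smul_apply, smul_eq_mul, abs_mul]
    rw [← Real.sqrt_sq (abs_nonneg a), ← Real.sqrt_mul (sq_nonneg _)]
    congr 1
    rw [Real.sqrt_sq (abs_nonneg a), ← sq_abs (a * x 0), ← sq_abs (a * x 1), abs_mul, abs_mul,
      ← sq_abs (x 0), ← sq_abs (x 1)]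
    ring
  eq_zero' x h := by
    have ht : 0 ≤ (t : ℝ) := t.2.1
    have h3 : 0 ≤ 2 * (t : ℝ) * (|x 0| * |x 1|) := by positivity
    rw [Real.sqrt_eq_zero (by positivity)] at h
    have hx0 : x 0 = 0 := by nlinarith [sq_nonneg (x 0), sq_nonneg (x 1)]
    have hx1 : x 1 = 0 := by nlinarith [sq_nonneg (x 0), sq_nonneg (x 1)]
    ext i
    fin_cases i <;> assumption

lemma planeNorm_sq (t : Set.Ico (0 : ℝ) 1) (x : Fin 2 → ℝ) :
    (planeNorm t).toFun x ^ 2 = x 0 ^ 2 + x 1 ^ 2 + 2 * t * (|x 0| * |x 1|) := by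
  have ht : 0 ≤ (t : ℝ) := t.2.1
  exact Real.sq_sqrt (by positivity)

/-- The von Neumann–Jordan constant of `planeNorm t` is at most `1 + t`. -/
lemma planeNorm_parallelogram_le (t : Set.Ico (0 : ℝ) 1) (x y : Fin 2 → ℝ) :
    (planeNorm t).toFun (x + y) ^ 2 + (planeNorm t).toFun (x - y) ^ 2 ≤
      2 * (1 + t) * ((planeNorm t).toFun x ^ 2 + (planeNorm t).toFun y ^ 2) := by
  obtain ⟨t, h0, h1⟩ := t
  simp only [planeNorm_sq, Pi.add_apply, Pi.sub_apply]
  generalize x 0 = a, x 1 = b, y 0 = c, y 1 = d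
  have h : |a + c| * |b + d| + |a - c| * |b - d| ≤
      (a ^ 2 + b ^ 2 + c ^ 2 + d ^ 2) + 2 * (|a| * |b| + |c| * |d|) := by
    rw [← abs_mul, ← abs_mul]
    have hab := abs_le.1 (abs_mul a b).le
    have hcd := abs_le.1 (abs_mul c d).le
    rcases abs_cases ((a + c) * (b + d)) with ⟨h1, -⟩ | ⟨h1, -⟩ <;>
      rcases abs_cases ((a - c) * (b - d)) with ⟨h2, -⟩ | ⟨h2, -⟩ <;>
      rw [h1, h2] <;>
      nlinarith [sq_nonneg (a - d), sq_nonneg (a + d), sq_nonneg (b - c), sq_nonneg (b + c),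
        sq_nonneg (a - b), sq_nonneg (a + b), sq_nonneg (c - d), sq_nonneg (c + d)]
  have hS : 0 ≤ |a| * |b| + |c| * |d| := by positivity
  nlinarith [mul_le_mul_of_nonneg_left h h0, mul_nonneg h0 (mul_nonneg h0 hS)]

lemma le_of_mDist_planeNorm_lt {s t : Set.Ico (0 : ℝ) 1} {c : ℝ}
    (h : mDist 2 (planeNorm t) (planeNorm s) < c) : 1 + (t : ℝ) ≤ c ^ 2 * (1 + s) := by
  obtain ⟨u, a, b, ha, hb, hab, h1, h2⟩ := MNorm.mDist_lt_iff.1 h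
  have hs : 0 ≤ (s : ℝ) := s.2.1
  let e : Fin 2 → ℝ := ![1, 0]
  let f : Fin 2 → ℝ := ![0, 1]
  have hp := planeNorm_parallelogram_le s (u e) (u f)
  have he : (planeNorm t).toFun e ^ 2 = 1 := by simp [planeNorm_sq, e]
  have hf : (planeNorm t).toFun f ^ 2 = 1 := by simp [planeNorm_sq, f]
  have hef : (planeNorm t).toFun (e + f) ^ 2 = 2 + 2 * t := by
    simp [planeNorm_sq, e, f]; ring
  have hef' : (planeNorm t).toFun (e - f) ^ 2 = 2 + 2 * t := by
    simp [planeNorm_sq, e, f]; ring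
  have up : ∀ x, (planeNorm s).toFun (u x) ^ 2 ≤ a ^ 2 * (planeNorm t).toFun x ^ 2 := by
    intro x
    rw [← mul_pow]
    exact pow_le_pow_left₀ (MNorm.nonneg _ _) (h1 x) 2
  have down : ∀ x, (planeNorm t).toFun x ^ 2 ≤ b ^ 2 * (planeNorm s).toFun (u x) ^ 2 := by
    intro x
    rw [← mul_pow]
    refine pow_le_pow_left₀ (MNorm.nonneg _ _) ?_ 2
    simpa using h2 (u x)
  have d1 := down (e + f)
  have d2 := down (e - f)
  rw [map_add, hef] at d1
  rw [map_sub, hef'] at d2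
  have u1 := up e
  have u2 := up f
  rw [he] at u1
  rw [hf] at u2
  have hbig : 4 + 4 * (t : ℝ) ≤ b ^ 2 * (2 * (1 + s) * (a ^ 2 + a ^ 2)) :=
    calc 4 + 4 * (t : ℝ) ≤ b ^ 2 * ((planeNorm s).toFun (u e + u f) ^ 2 +
          (planeNorm s).toFun (u e - u f) ^ 2) := by linarith
      _ ≤ b ^ 2 * (2 * (1 + s) * ((planeNorm s).toFun (u e) ^ 2 +
          (planeNorm s).toFun (u f) ^ 2)) := by gcongr
      _ ≤ b ^ 2 * (2 * (1 + s) * (a ^ 2 + a ^ 2)) := by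
        have := add_le_add u1 u2
        rw [mul_one] at this
        exact mul_le_mul_of_nonneg_left (mul_le_mul_of_nonneg_left this (by positivity))
          (sq_nonneg b)
  have hc : (a * b) ^ 2 ≤ c ^ 2 := pow_le_pow_left₀ (by positivity) hab.le 2
  have := mul_le_mul_of_nonneg_right hc (by positivity : 0 ≤ 1 + (s : ℝ))
  nlinarith

/-- `ℝ^n` with the norm `N`, as a Banach space. -/
def MNorm.banachSpace {n : ℕ} (N : MNorm n) : BanachSpace.{u} :=
  letI : FiniteDimensional ℝ (ULift.{u} N.Space) :=
    (ULift.moduleEquiv (R := ℝ) (M := N.Space)).symm.finiteDimensional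
  { carrier := ULift.{u} N.Space
    complete := FiniteDimensional.complete ℝ _ }

lemma mem_HSet_banachSpace_iff {n : ℕ} (N : MNorm n) (P : Mink n) :
    (⟨n, P⟩ : MinkSpace) ∈ HSet N.banachSpace.{u}.carrier ↔ P = N.toMink := by
  constructor
  · rintro ⟨f, hf, hN⟩
    let g : (Fin n → ℝ) →ₗ[ℝ] (Fin n → ℝ) :=
      N.equivSpace.symm.toLinearMap ∘ₗ (ULift.moduleEquiv (R := ℝ) (M := N.Space)).toLinearMap ∘ₗ f
    have hg : Function.Injective g :=
      N.equivSpace.symm.injective.comp ((ULift.moduleEquiv (R := ℝ) (M := N.Space)).injective.comp hf)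
    rw [← MNorm.toMink_out P]
    exact Quotient.sound ⟨LinearEquiv.ofInjectiveEndo g hg, fun x => hN x⟩
  · rintro rfl
    obtain ⟨e, he⟩ := N.out_toMink_rel
    exact ⟨(ULift.moduleEquiv (R := ℝ) (M := N.Space)).symm.toLinearMap ∘ₗ
      N.equivSpace.toLinearMap ∘ₗ e.toLinearMap,
      (ULift.moduleEquiv (R := ℝ) (M := N.Space)).symm.injective.comp
        (N.equivSpace.injective.comp e.injective),
      fun x => he x⟩

lemma closure_HSet_planeNorm_ne {s t : Set.Ico (0 : ℝ) 1} (hst : s < t) :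
    closure (HSet (planeNorm s).banachSpace.{u}.carrier) ≠
      closure (HSet (planeNorm t).banachSpace.{u}.carrier) := by
  intro heq
  have hs : 0 ≤ (s : ℝ) := s.2.1
  have hst' : (s : ℝ) < t := hst
  obtain ⟨ε, hlt, hε⟩ : ∃ ε : ℝ, Real.exp ε ^ 2 * (1 + s) < 1 + t ∧ 0 < ε := by
    have hcont : ContinuousAt (fun ε : ℝ => Real.exp ε ^ 2 * (1 + (s : ℝ))) 0 := by fun_prop
    have hev := hcont.eventually_lt_const (show _ < 1 + (t : ℝ) by simpa using hst')
    exact ((hev.filter_mono nhdsWithin_le_nhds).and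
      (self_mem_nhdsWithin : Set.Ioi (0 : ℝ) ∈ nhdsWithin 0 (Set.Ioi 0))).exists
  let P : Mink 2 := (planeNorm t).toMink
  have hP : (⟨2, P⟩ : MinkSpace) ∈ closure (HSet (planeNorm s).banachSpace.{u}.carrier) := by
    rw [heq]
    exact subset_closure ((mem_HSet_banachSpace_iff _ _).2 rfl)
  have hopen : IsOpen (Sigma.mk 2 '' {Q : Mink 2 | minkDist 2 P Q < ε} : Set MinkSpace) :=
    isOpenMap_sigmaMk _ (TopologicalSpace.isOpen_generateFrom_of_mem ⟨P, ε, hε, rfl⟩)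
  have hself : minkDist 2 P P < ε := by
    refine (MNorm.minkDist_toMink_lt_iff _ _ hε).2 (MNorm.mDist_lt_iff.2
      ⟨LinearEquiv.refl ℝ _, 1, 1, zero_le_one, zero_le_one, by simpa using hε, ?_, ?_⟩) <;> simp
  obtain ⟨_, ⟨Q, hQ, rfl⟩, hQ'⟩ := mem_closure_iff.1 hP _ hopen ⟨P, hself, rfl⟩
  obtain rfl := (mem_HSet_banachSpace_iff _ _).1 hQ'
  exact absurd (le_of_mDist_planeNorm_lt ((MNorm.minkDist_toMink_lt_iff _ _ hε).1 hQ)) hlt.not_ge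

/-- The set of all Minkowski bases of classes of finite equivalence,
i.e. the set of closures in `𝔐` of the sets `H(X)` for `X` a Banach space, has cardinality
exactly the continuum. -/
theorem card_minkowski_bases_eq_continuum :
    Cardinal.mk {s : Set MinkSpace | ∃ X : BanachSpace.{u}, s = closure (HSet X.carrier)} =
      Cardinal.continuum := by
  refine le_antisymm (le_trans (Cardinal.mk_le_mk_of_subset ?_) mk_isClosed_minkSpace_le) ?_
  · rintro _ ⟨X, rfl⟩
    exact isClosed_closure
  · rw [← Cardinal.mk_Ico_real one_pos]
    refine Cardinal.mk_le_of_injective (f := fun t : Set.Ico (0 : ℝ) 1 =>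
      ⟨_, (planeNorm t).banachSpace, rfl⟩) ?_
    intro s t h
    have h' := congrArg Subtype.val h
    by_contra hne
    rcases lt_or_gt_of_ne hne with hlt | hlt
    · exact closure_HSet_planeNorm_ne hlt h'
    · exact closure_HSet_planeNorm_ne hlt h'.symm
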